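/- arXiv:2604.27481 — 3 statements merged into one kernel-verified Lean document; each statement's English description precedes it below -/
import Mathlib

section
/- Let (E, ∇̄_E) be a holomorphic vector bundle over a noncommutative complex curve A, and suppose E = E₁ ⊕ ⋯ ⊕ Eₙ as left A-modules, where each Eⱼ is a finitely generated projective left A-submodule with ∇̄_E(Eⱼ) ⊆ Ω⁰¹ ⊗_A Eⱼ, so that each (Eⱼ, ∇̄_E|_{Eⱼ}) is a holomorphic vector bundle. Then (E, ∇̄_E) admits a holomorphic connection if and only if each (Eⱼ, ∇̄_E|_{Eⱼ}) admits a holomorphic connection. -/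
open MulOpposite Finset

open scoped TensorProduct

/-- A universal property for balanced maps, tested in one fixed universe, implies the universal
property for targets in any universe. -/
theorem exists_lift_of_balanced {R X Y T W : Type*} [Ring R]
    [AddCommGroup X] [Module ℂ X] [Module Rᵐᵒᵖ X] [AddCommGroup Y] [Module ℂ Y] [Module R Y]
    [AddCommGroup T] [Module ℂ T] [AddCommGroup W] [Module ℂ W]
    (t : X →ₗ[ℂ] Y →ₗ[ℂ] T)
    (hspan : Submodule.span ℂ {z : T | ∃ x y, z = t x y} = ⊤)
    (huniv : ∀ (V : Type*) [AddCommGroup V] [Module ℂ V] (f : X →ₗ[ℂ] Y →ₗ[ℂ] V),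
      (∀ (x : X) (a : R) (y : Y), f (op a • x) y = f x (a • y)) →
        ∃ g : T →ₗ[ℂ] V, ∀ x y, g (t x y) = f x y)
    (f : X →ₗ[ℂ] Y →ₗ[ℂ] W)
    (hf : ∀ (x : X) (a : R) (y : Y), f (op a • x) y = f x (a • y)) :
    ∃ g : T →ₗ[ℂ] W, ∀ x y, g (t x y) = f x y := by
  have hsurj : LinearMap.range (TensorProduct.lift t) = ⊤ := by
    rw [eq_top_iff, ← hspan, Submodule.span_le]
    rintro _ ⟨x, y, rfl⟩
    exact ⟨x ⊗ₜ[ℂ] y, TensorProduct.lift.tmul x y⟩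
  have hker : ∀ z, TensorProduct.lift t z = 0 → TensorProduct.lift f z = 0 := by
    intro z hz
    rw [← Module.forall_dual_apply_eq_zero_iff ℂ]
    intro φ
    obtain ⟨g, hg⟩ := huniv (ULift ℂ)
      (f.compr₂ (ULift.moduleEquiv.symm.toLinearMap ∘ₗ φ)) (by simp [hf])
    have hcomp : g ∘ₗ TensorProduct.lift t =
        (ULift.moduleEquiv.symm.toLinearMap ∘ₗ φ) ∘ₗ TensorProduct.lift f := by
      ext x y
      simp [hg]
    have := congrArg ULift.down (LinearMap.congr_fun hcomp z)
    simpa [hz] using this.symm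
  obtain ⟨s, hs⟩ := (TensorProduct.lift t).exists_rightInverse_of_surjective hsurj
  refine ⟨TensorProduct.lift f ∘ₗ s, fun x y => ?_⟩
  have := hker (s (t x y) - x ⊗ₜ[ℂ] y) (by
    rw [map_sub, TensorProduct.lift.tmul, ← LinearMap.comp_apply, hs, LinearMap.id_apply, sub_self])
  rwa [map_sub, TensorProduct.lift.tmul, sub_eq_zero] at this

theorem eq_of_eq_on_bilinear_image {X Y T W : Type*}
    [AddCommGroup X] [Module ℂ X] [AddCommGroup Y] [Module ℂ Y]
    [AddCommGroup T] [Module ℂ T] [AddCommGroup W] [Module ℂ W]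
    (t : X →ₗ[ℂ] Y →ₗ[ℂ] T)
    (hspan : Submodule.span ℂ {z : T | ∃ x y, z = t x y} = ⊤)
    (f g : T →ₗ[ℂ] W) (h : ∀ x y, f (t x y) = g (t x y)) (z : T) : f z = g z := by
  refine LinearMap.congr_fun (LinearMap.ext_on hspan ?_) z
  rintro _ ⟨x, y, rfl⟩
  exact h x y

theorem exists_sum_of_mem_span_bilinear {X Y Y' T : Type*}
    [AddCommGroup X] [Module ℂ X] [AddCommGroup Y] [Module ℂ Y] [AddCommGroup T] [Module ℂ T]
    (t : X →ₗ[ℂ] Y →ₗ[ℂ] T) (h : Y' → Y) {z : T}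
    (hz : z ∈ Submodule.span ℂ {z : T | ∃ x y, z = t x (h y)}) :
    ∃ (N : ℕ) (x : Fin N → X) (y : Fin N → Y'), z = ∑ i, t (x i) (h (y i)) := by
  obtain ⟨N, c, g, rfl⟩ := Submodule.mem_span_set'.1 hz
  choose x y hxy using fun i => (g i).2
  exact ⟨N, fun i => c i • x i, y, by simp [hxy]⟩

/-- The endomorphism of `X ⊗ ⨁ⱼ Eⱼ` projecting to the `j`-th summand. -/
theorem exists_summand_projection {R X T ι : Type*} [DecidableEq ι] {E : ι → Type*} [Ring R]
    [AddCommGroup X] [Module ℂ X] [Module Rᵐᵒᵖ X]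
    [∀ j, AddCommGroup (E j)] [∀ j, Module ℂ (E j)] [∀ j, Module R (E j)]
    [AddCommGroup T] [Module ℂ T]
    (t : X →ₗ[ℂ] (∀ j, E j) →ₗ[ℂ] T)
    (hbal : ∀ (x : X) (a : R) (e : ∀ j, E j), t (op a • x) e = t x (a • e))
    (hspan : Submodule.span ℂ {z : T | ∃ x y, z = t x y} = ⊤)
    (huniv : ∀ (V : Type*) [AddCommGroup V] [Module ℂ V] (f : X →ₗ[ℂ] (∀ j, E j) →ₗ[ℂ] V),
      (∀ (x : X) (a : R) (e : ∀ j, E j), f (op a • x) e = f x (a • e)) →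
        ∃ g : T →ₗ[ℂ] V, ∀ x e, g (t x e) = f x e) (j : ι) :
    ∃ p : T →ₗ[ℂ] T, ∀ x e, p (t x e) = t x (Pi.single j (e j)) := by
  obtain ⟨p, hp⟩ := exists_lift_of_balanced t hspan huniv
    (t.compl₂ (LinearMap.single ℂ E j ∘ₗ LinearMap.proj j)) (by
      intro x a e
      simp [hbal, Pi.single_smul])
  exact ⟨p, fun x e => by simp [hp]⟩

variable {A : Type*} [Ring A] [Algebra ℂ A]
variable {Ω10 : Type*} [AddCommGroup Ω10] [Module ℂ Ω10] [Module A Ω10] [Module Aᵐᵒᵖ Ω10]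
  [IsScalarTower ℂ A Ω10] [IsScalarTower ℂ Aᵐᵒᵖ Ω10] [SMulCommClass A Aᵐᵒᵖ Ω10]
variable {Ω01 : Type*} [AddCommGroup Ω01] [Module ℂ Ω01] [Module A Ω01] [Module Aᵐᵒᵖ Ω01]
  [IsScalarTower ℂ A Ω01] [IsScalarTower ℂ Aᵐᵒᵖ Ω01] [SMulCommClass A Aᵐᵒᵖ Ω01]
variable {Ω11 : Type*} [AddCommGroup Ω11] [Module ℂ Ω11] [Module A Ω11] [Module Aᵐᵒᵖ Ω11]
  [IsScalarTower ℂ A Ω11] [IsScalarTower ℂ Aᵐᵒᵖ Ω11] [SMulCommClass A Aᵐᵒᵖ Ω11]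
variable [Module.Finite A Ω10] [Module.Projective A Ω10]
variable {n : ℕ} {Ej : Fin n → Type*} [∀ j, AddCommGroup (Ej j)] [∀ j, Module ℂ (Ej j)]
  [∀ j, Module A (Ej j)] [∀ j, IsScalarTower ℂ A (Ej j)]
  [∀ j, Module.Finite A (Ej j)] [∀ j, Module.Projective A (Ej j)]
variable [Module.Finite A (∀ j, Ej j)] [Module.Projective A (∀ j, Ej j)]
variable {T01E : Type*} [AddCommGroup T01E] [Module ℂ T01E] [Module A T01E] [IsScalarTower ℂ A T01E]
variable {T10E : Type*} [AddCommGroup T10E] [Module ℂ T10E] [Module A T10E] [IsScalarTower ℂ A T10E]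
variable {T11E : Type*} [AddCommGroup T11E] [Module ℂ T11E] [Module A T11E] [IsScalarTower ℂ A T11E]
variable {T011E : Type*} [AddCommGroup T011E] [Module ℂ T011E] [Module A T011E] [IsScalarTower ℂ A T011E]

theorem stmt_12
    (pd : A →ₗ[ℂ] Ω10)
    (hpd : ∀ a b : A, pd (a * b) = a • pd b + op b • pd a)
    (pdb : A →ₗ[ℂ] Ω01)
    (hpdb : ∀ a b : A, pdb (a * b) = a • pdb b + op b • pdb a)
    (w10 : Ω10 →ₗ[ℂ] Ω01 →ₗ[ℂ] Ω11)
    (hw10l : ∀ (a : A) (ω : Ω10) (η : Ω01), w10 (a • ω) η = a • w10 ω η)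
    (hw10r : ∀ (ω : Ω10) (η : Ω01) (a : A), w10 ω (op a • η) = op a • w10 ω η)
    (hw10bal : ∀ (ω : Ω10) (a : A) (η : Ω01), w10 (op a • ω) η = w10 ω (a • η))
    (w01 : Ω01 →ₗ[ℂ] Ω10 →ₗ[ℂ] Ω11)
    (hw01l : ∀ (a : A) (η : Ω01) (ω : Ω10), w01 (a • η) ω = a • w01 η ω)
    (hw01r : ∀ (η : Ω01) (ω : Ω10) (a : A), w01 η (op a • ω) = op a • w01 η ω)
    (hw01bal : ∀ (η : Ω01) (a : A) (ω : Ω10), w01 (op a • η) ω = w01 η (a • ω))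
    (pdb1 : Ω10 →ₗ[ℂ] Ω11)
    (pd1 : Ω01 →ₗ[ℂ] Ω11)
    (hpdb1l : ∀ (a : A) (ω : Ω10), pdb1 (a • ω) = w01 (pdb a) ω + a • pdb1 ω)
    (hpdb1r : ∀ (ω : Ω10) (a : A), pdb1 (op a • ω) = op a • pdb1 ω - w10 ω (pdb a))
    (hpd1l : ∀ (a : A) (η : Ω01), pd1 (a • η) = w10 (pd a) η + a • pd1 η)
    (hpd1r : ∀ (η : Ω01) (a : A), pd1 (op a • η) = op a • pd1 η - w01 η (pd a))
    (hmixed : ∀ a : A, pd1 (pdb a) + pdb1 (pd a) = 0)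
    (hspanΩ11 : Submodule.span ℂ {x : Ω11 | ∃ η ω, x = w01 η ω} = ⊤)
    (hμuniv : ∀ (V : Type*) [AddCommGroup V] [Module ℂ V] (f : Ω01 →ₗ[ℂ] Ω10 →ₗ[ℂ] V), (∀ (η : Ω01) (a : A) (ω : Ω10), f (op a • η) ω = f η (a • ω)) → ∃ g : Ω11 →ₗ[ℂ] V, ∀ η ω, g (w01 η ω) = f η ω)
    (t01E : Ω01 →ₗ[ℂ] (∀ j, Ej j) →ₗ[ℂ] T01E)
    (ht01El : ∀ (a : A) (η : Ω01) (e : (∀ j, Ej j)), t01E (a • η) e = a • t01E η e)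
    (ht01Ebal : ∀ (η : Ω01) (a : A) (e : (∀ j, Ej j)), t01E (op a • η) e = t01E η (a • e))
    (ht01Espan : Submodule.span ℂ {z : T01E | ∃ η e, z = t01E η e} = ⊤)
    (ht01Euniv : ∀ (V : Type*) [AddCommGroup V] [Module ℂ V] (f : Ω01 →ₗ[ℂ] (∀ j, Ej j) →ₗ[ℂ] V), (∀ (η : Ω01) (a : A) (e : (∀ j, Ej j)), f (op a • η) e = f η (a • e)) → ∃ g : T01E →ₗ[ℂ] V, ∀ η e, g (t01E η e) = f η e)
    (nabE : (∀ j, Ej j) →ₗ[ℂ] T01E)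
    (hnabE : ∀ (a : A) (e : (∀ j, Ej j)), nabE (a • e) = a • nabE e + t01E (pdb a) e)
    (t10E : Ω10 →ₗ[ℂ] (∀ j, Ej j) →ₗ[ℂ] T10E)
    (ht10El : ∀ (a : A) (ω : Ω10) (e : (∀ j, Ej j)), t10E (a • ω) e = a • t10E ω e)
    (ht10Ebal : ∀ (ω : Ω10) (a : A) (e : (∀ j, Ej j)), t10E (op a • ω) e = t10E ω (a • e))
    (ht10Espan : Submodule.span ℂ {z : T10E | ∃ ω e, z = t10E ω e} = ⊤)
    (ht10Euniv : ∀ (V : Type*) [AddCommGroup V] [Module ℂ V] (f : Ω10 →ₗ[ℂ] (∀ j, Ej j) →ₗ[ℂ] V), (∀ (ω : Ω10) (a : A) (e : (∀ j, Ej j)), f (op a • ω) e = f ω (a • e)) → ∃ g : T10E →ₗ[ℂ] V, ∀ ω e, g (t10E ω e) = f ω e)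
    (t11E : Ω11 →ₗ[ℂ] (∀ j, Ej j) →ₗ[ℂ] T11E)
    (ht11El : ∀ (a : A) (ρ : Ω11) (e : (∀ j, Ej j)), t11E (a • ρ) e = a • t11E ρ e)
    (ht11Ebal : ∀ (ρ : Ω11) (a : A) (e : (∀ j, Ej j)), t11E (op a • ρ) e = t11E ρ (a • e))
    (ht11Espan : Submodule.span ℂ {z : T11E | ∃ ρ e, z = t11E ρ e} = ⊤)
    (ht11Euniv : ∀ (V : Type*) [AddCommGroup V] [Module ℂ V] (f : Ω11 →ₗ[ℂ] (∀ j, Ej j) →ₗ[ℂ] V), (∀ (ρ : Ω11) (a : A) (e : (∀ j, Ej j)), f (op a • ρ) e = f ρ (a • e)) → ∃ g : T11E →ₗ[ℂ] V, ∀ ρ e, g (t11E ρ e) = f ρ e)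
    (t011E : Ω01 →ₗ[ℂ] T10E →ₗ[ℂ] T011E)
    (ht011El : ∀ (a : A) (η : Ω01) (ξ : T10E), t011E (a • η) ξ = a • t011E η ξ)
    (ht011Ebal : ∀ (η : Ω01) (a : A) (ξ : T10E), t011E (op a • η) ξ = t011E η (a • ξ))
    (ht011Espan : Submodule.span ℂ {z : T011E | ∃ η ξ, z = t011E η ξ} = ⊤)
    (ht011Euniv : ∀ (V : Type*) [AddCommGroup V] [Module ℂ V] (f : Ω01 →ₗ[ℂ] T10E →ₗ[ℂ] V), (∀ (η : Ω01) (a : A) (ξ : T10E), f (op a • η) ξ = f η (a • ξ)) → ∃ g : T011E →ₗ[ℂ] V, ∀ η ξ, g (t011E η ξ) = f η ξ)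
    (wE : Ω10 →ₗ[ℂ] T01E →ₗ[ℂ] T11E)
    (hwE : ∀ (ω : Ω10) (η : Ω01) (e : (∀ j, Ej j)), wE ω (t01E η e) = t11E (w10 ω η) e)
    (hwEl : ∀ (a : A) (ω : Ω10) (x : T01E), wE (a • ω) x = a • wE ω x)
    (hwEbal : ∀ (ω : Ω10) (a : A) (x : T01E), wE (op a • ω) x = wE ω (a • x))
    (μE : T011E ≃ₗ[ℂ] T11E)
    (hμE : ∀ (η : Ω01) (ω : Ω10) (e : (∀ j, Ej j)), μE (t011E η (t10E ω e)) = t11E (w01 η ω) e)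
    (hμEl : ∀ (a : A) (x : T011E), μE (a • x) = a • μE x)
    (hsub : ∀ (j : Fin n) (x : Ej j), nabE (Pi.single j x) ∈ Submodule.span ℂ {y : T01E | ∃ (η : Ω01) (e : Ej j), y = t01E η (Pi.single j e)})
    :
    -- E admits a holomorphic connection
    (∃ pcon : (∀ j, Ej j) →ₗ[ℂ] T10E,
      (∀ (a : A) (x : (∀ j, Ej j)), pcon (a • x) = a • pcon x + t10E (pd a) x) ∧
      (∀ (x : (∀ j, Ej j)) (N M : ℕ) (ω : Fin N → Ω10) (u : Fin N → (∀ j, Ej j))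
          (η : Fin M → Ω01) (f : Fin M → (∀ j, Ej j)),
        pcon x = ∑ i, t10E (ω i) (u i) → nabE x = ∑ l, t01E (η l) (f l) →
        (∑ i, (t11E (pdb1 (ω i)) (u i) - wE (ω i) (nabE (u i))))
          + (∑ l, (t11E (pd1 (η l)) (f l) - μE (t011E (η l) (pcon (f l))))) = 0))
    ↔
    -- each holomorphic subbundle Ej admits a holomorphic connection
    (∀ j : Fin n, ∃ pconj : Ej j →ₗ[ℂ] T10E,
      (∀ x : Ej j, pconj x ∈ Submodule.span ℂ
          {y : T10E | ∃ (ω : Ω10) (e : Ej j), y = t10E ω (Pi.single j e)}) ∧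
      (∀ (a : A) (x : Ej j), pconj (a • x) = a • pconj x + t10E (pd a) (Pi.single j x)) ∧
      (∀ (x : Ej j) (N M : ℕ) (ω : Fin N → Ω10) (u : Fin N → Ej j)
          (η : Fin M → Ω01) (f : Fin M → Ej j),
        pconj x = ∑ i, t10E (ω i) (Pi.single j (u i)) →
        nabE (Pi.single j x) = ∑ l, t01E (η l) (Pi.single j (f l)) →
        (∑ i, (t11E (pdb1 (ω i)) (Pi.single j (u i)) - wE (ω i) (nabE (Pi.single j (u i)))))
          + (∑ l, (t11E (pd1 (η l)) (Pi.single j (f l)) - μE (t011E (η l) (pconj (f l))))) = 0)) := by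
  obtain ⟨D, hD⟩ : ∃ D : T10E →ₗ[ℂ] T11E,
      ∀ ω u, D (t10E ω u) = t11E (pdb1 ω) u - wE ω (nabE u) := by
    refine exists_lift_of_balanced t10E ht10Espan ht10Euniv
      (t11E ∘ₗ pdb1 - wE.compl₂ nabE) fun ω a u => ?_
    simp only [LinearMap.sub_apply, LinearMap.comp_apply, LinearMap.compl₂_apply, hpdb1r, map_sub,
      ht11Ebal, hwEbal, hnabE, map_add, hwE]
    abel
  constructor
  · rintro ⟨pcon, hleib, hflat⟩ j
    obtain ⟨p10, hp10⟩ := exists_summand_projection t10E ht10Ebal ht10Espan ht10Euniv j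
    obtain ⟨p01, hp01⟩ := exists_summand_projection t01E ht01Ebal ht01Espan ht01Euniv j
    obtain ⟨p11, hp11⟩ := exists_summand_projection t11E ht11Ebal ht11Espan ht11Euniv j
    have hp10l (a : A) (z : T10E) : p10 (a • z) = a • p10 z :=
      eq_of_eq_on_bilinear_image t10E ht10Espan (p10 ∘ₗ Algebra.lsmul ℂ ℂ T10E a)
        (Algebra.lsmul ℂ ℂ T10E a ∘ₗ p10) (fun ω e => by simp [← ht10El, hp10]) z
    have hpw (ω : Ω10) (y : T01E) : p11 (wE ω y) = wE ω (p01 y) :=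
      eq_of_eq_on_bilinear_image t01E ht01Espan (p11 ∘ₗ wE ω) (wE ω ∘ₗ p01)
        (fun η e => by simp [hwE, hp01, hp11]) y
    have hpμ (η : Ω01) (z : T10E) : p11 (μE (t011E η z)) = μE (t011E η (p10 z)) :=
      eq_of_eq_on_bilinear_image t10E ht10Espan (p11 ∘ₗ μE.toLinearMap ∘ₗ t011E η)
        (μE.toLinearMap ∘ₗ t011E η ∘ₗ p10) (fun ω e => by simp [hμE, hp10, hp11]) z
    have hpnab (u : ∀ j, Ej j) : p01 (nabE u) = nabE (Pi.single j (u j)) := by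
      have hsingle (k : Fin n) (x : Ej k) :
          p01 (nabE (Pi.single k x)) = nabE (Pi.single j ((Pi.single k x : ∀ j, Ej j) j)) := by
        obtain ⟨N, η, e, h⟩ := exists_sum_of_mem_span_bilinear t01E (Pi.single k) (hsub k x)
        by_cases hk : k = j
        · subst hk
          simp [h, hp01]
        · simp [h, hp01, Pi.single_eq_of_ne (Ne.symm hk)]
      exact LinearMap.congr_fun (LinearMap.pi_ext (f := p01 ∘ₗ nabE)
        (g := nabE ∘ₗ LinearMap.single ℂ Ej j ∘ₗ LinearMap.proj j) hsingle) u
    have hpD (z : T10E) : p11 (D z) = D (p10 z) :=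
      eq_of_eq_on_bilinear_image t10E ht10Espan (p11 ∘ₗ D) (D ∘ₗ p10)
        (fun ω e => by simp [hD, hp10, hp11, hpw, hpnab]) z
    refine ⟨p10 ∘ₗ pcon ∘ₗ LinearMap.single ℂ Ej j, fun x => ?_, fun a x => ?_, ?_⟩
    · have hz : pcon (Pi.single j x) ∈ Submodule.span ℂ {z : T10E | ∃ ω e, z = t10E ω (id e)} := by
        simp [ht10Espan]
      obtain ⟨N, ω, u, h⟩ := exists_sum_of_mem_span_bilinear t10E id hz
      simp only [LinearMap.comp_apply, LinearMap.single_apply, h, map_sum, hp10, id]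
      exact Submodule.sum_mem _ fun i _ => Submodule.subset_span ⟨_, _, rfl⟩
    · simp [Pi.single_smul, hleib, hp10l, hp10]
    · intro x N M ω u η f h1 h2
      have hz : pcon (Pi.single j x) ∈ Submodule.span ℂ {z : T10E | ∃ ω e, z = t10E ω (id e)} := by
        simp [ht10Espan]
      obtain ⟨K, ω', u', h⟩ := exists_sum_of_mem_span_bilinear t10E id hz
      have key := congrArg p11 (hflat _ K M ω' u' η (fun l => Pi.single j (f l)) h h2)
      have hD' : ∑ i, (t11E (pdb1 (ω' i)) (u' i) - wE (ω' i) (nabE (u' i))) =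
          D (pcon (Pi.single j x)) := by
        simp [h, hD]
      have hD'' : ∑ i, (t11E (pdb1 (ω i)) (Pi.single j (u i))
          - wE (ω i) (nabE (Pi.single j (u i)))) = D (p10 (pcon (Pi.single j x))) := by
        have h1' : p10 (pcon (Pi.single j x)) = _ := h1
        simp [h1', hD]
      rw [hD', map_add, hpD, map_zero] at key
      rw [hD'', ← key]
      simp [hp11, hpμ]
  · intro H
    choose pconj hmem hleib hflat using H
    obtain ⟨pcon, hpcon⟩ : ∃ pcon : (∀ j, Ej j) →ₗ[ℂ] T10E, ∀ x, pcon x = ∑ j, pconj j (x j) :=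
      ⟨∑ j, pconj j ∘ₗ LinearMap.proj j, fun x => by simp⟩
    have hpcon_single (j : Fin n) (e : Ej j) : pcon (Pi.single j e) = pconj j e := by
      rw [hpcon, Finset.sum_eq_single j]
      · simp
      · intro k _ hk
        simp [Pi.single_eq_of_ne hk]
      · simp
    have hleib' (a : A) (x : ∀ j, Ej j) : pcon (a • x) = a • pcon x + t10E (pd a) x := by
      conv_rhs => rw [← Finset.univ_sum_single x]
      simp only [map_sum, hpcon_single, Finset.smul_sum, ← Finset.sum_add_distrib]
      simp [hpcon, hleib]
    obtain ⟨G, hG⟩ : ∃ G : T01E →ₗ[ℂ] T11E,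
        ∀ η f, G (t01E η f) = t11E (pd1 η) f - μE (t011E η (pcon f)) := by
      refine exists_lift_of_balanced t01E ht01Espan ht01Euniv
        (t11E ∘ₗ pd1 - (t011E.compl₂ pcon).compr₂ μE.toLinearMap) fun η a f => ?_
      simp only [LinearMap.sub_apply, LinearMap.comp_apply, LinearMap.compl₂_apply,
        LinearMap.compr₂_apply, LinearEquiv.coe_coe, hpd1r, map_sub,
        ht11Ebal, ht011Ebal, hleib', map_add, hμE]
      abel
    have hcurv (j : Fin n) (e : Ej j) : D (pconj j e) + G (nabE (Pi.single j e)) = 0 := by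
      obtain ⟨N, ω, u, h1⟩ := exists_sum_of_mem_span_bilinear t10E (Pi.single j) (hmem j e)
      obtain ⟨M, η, f, h2⟩ := exists_sum_of_mem_span_bilinear t01E (Pi.single j) (hsub j e)
      rw [← hflat j e N M ω u η f h1 h2, h1, h2]
      simp only [map_sum, hD, hG, hpcon_single]
    refine ⟨pcon, hleib', fun x N M ω u η f h1 h2 => ?_⟩
    simp only [← hD, ← hG, ← map_sum]
    rw [← h1, ← h2]
    exact LinearMap.congr_fun (LinearMap.pi_ext (f := D ∘ₗ pcon + G ∘ₗ nabE) (g := 0)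
      fun j e => by simpa [hpcon_single] using hcurv j e) x
end

section
/- Let E be an A-bimodule over a noncommutative complex curve A, σ_E : E ⊗_A Ω¹⁰ → Ω¹⁰ ⊗_A E an A-bimodule map, ∇¹⁰ a σ_E-bimodule ∂-connection on E, and Φ₂ : Ω⁰¹ ⊗_A Ω¹⁰ → Ω¹⁰ ⊗_A Ω⁰¹ an A-bimodule map. Then Ψ_∇ is a right ((Φ₂ ⊗ id_E) ∘ (id_{Ω⁰¹} ⊗ σ_E))-connection on Ω⁰¹ ⊗_A E: for all ω′ ∈ Ω⁰¹, e ∈ E and b ∈ A, Ψ_∇((ω′ ⊗ e)·b) = Ψ_∇(ω′ ⊗ e)·b + ((Φ₂ ⊗ id_E) ∘ (id_{Ω⁰¹} ⊗ σ_E))(ω′ ⊗ e ⊗ ∂b). -/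
open MulOpposite Finset

theorem LinearMap.map_smul_of_span_eq_top {R S M N : Type*} [Semiring R] [Monoid S]
    [AddCommMonoid M] [AddCommMonoid N] [Module R M] [Module R N]
    [DistribMulAction S M] [DistribMulAction S N] [SMulCommClass S R M] [SMulCommClass S R N]
    {t : Set M} (ht : Submodule.span R t = ⊤) (f : M →ₗ[R] N) (s : S)
    (h : ∀ x ∈ t, f (s • x) = s • f x) (x : M) : f (s • x) = s • f x :=
  LinearMap.congr_fun (LinearMap.ext_on (f := f ∘ₗ DistribSMul.toLinearMap R M s)
    (g := DistribSMul.toLinearMap R N s ∘ₗ f) ht h) x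

variable {A : Type*} [Ring A] [Algebra ℂ A]
variable {Ω10 : Type*} [AddCommGroup Ω10] [Module ℂ Ω10] [Module A Ω10] [Module Aᵐᵒᵖ Ω10]
  [IsScalarTower ℂ A Ω10] [IsScalarTower ℂ Aᵐᵒᵖ Ω10] [SMulCommClass A Aᵐᵒᵖ Ω10]
variable {Ω01 : Type*} [AddCommGroup Ω01] [Module ℂ Ω01] [Module A Ω01] [Module Aᵐᵒᵖ Ω01]
  [IsScalarTower ℂ A Ω01] [IsScalarTower ℂ Aᵐᵒᵖ Ω01] [SMulCommClass A Aᵐᵒᵖ Ω01]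
variable {Ω11 : Type*} [AddCommGroup Ω11] [Module ℂ Ω11] [Module A Ω11] [Module Aᵐᵒᵖ Ω11]
  [IsScalarTower ℂ A Ω11] [IsScalarTower ℂ Aᵐᵒᵖ Ω11] [SMulCommClass A Aᵐᵒᵖ Ω11]
variable [Module.Finite A Ω10] [Module.Projective A Ω10]
variable {E : Type*} [AddCommGroup E] [Module ℂ E] [Module A E] [Module Aᵐᵒᵖ E]
  [IsScalarTower ℂ A E] [IsScalarTower ℂ Aᵐᵒᵖ E] [SMulCommClass A Aᵐᵒᵖ E]
variable [Module.Finite A E] [Module.Projective A E]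
variable {T01E : Type*} [AddCommGroup T01E] [Module ℂ T01E] [Module A T01E] [Module Aᵐᵒᵖ T01E]
  [IsScalarTower ℂ A T01E] [IsScalarTower ℂ Aᵐᵒᵖ T01E] [SMulCommClass A Aᵐᵒᵖ T01E]
variable {T10E : Type*} [AddCommGroup T10E] [Module ℂ T10E] [Module A T10E] [Module Aᵐᵒᵖ T10E]
  [IsScalarTower ℂ A T10E] [IsScalarTower ℂ Aᵐᵒᵖ T10E] [SMulCommClass A Aᵐᵒᵖ T10E]
variable {TE10 : Type*} [AddCommGroup TE10] [Module ℂ TE10] [Module A TE10] [Module Aᵐᵒᵖ TE10]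
  [IsScalarTower ℂ A TE10] [IsScalarTower ℂ Aᵐᵒᵖ TE10] [SMulCommClass A Aᵐᵒᵖ TE10]
variable {TE01 : Type*} [AddCommGroup TE01] [Module ℂ TE01] [Module A TE01] [Module Aᵐᵒᵖ TE01]
  [IsScalarTower ℂ A TE01] [IsScalarTower ℂ Aᵐᵒᵖ TE01] [SMulCommClass A Aᵐᵒᵖ TE01]
variable {T011E : Type*} [AddCommGroup T011E] [Module ℂ T011E] [Module A T011E] [Module Aᵐᵒᵖ T011E]
  [IsScalarTower ℂ A T011E] [IsScalarTower ℂ Aᵐᵒᵖ T011E] [SMulCommClass A Aᵐᵒᵖ T011E]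
variable {T11E : Type*} [AddCommGroup T11E] [Module ℂ T11E] [Module A T11E] [Module Aᵐᵒᵖ T11E]
  [IsScalarTower ℂ A T11E] [IsScalarTower ℂ Aᵐᵒᵖ T11E] [SMulCommClass A Aᵐᵒᵖ T11E]
variable {T0110 : Type*} [AddCommGroup T0110] [Module ℂ T0110] [Module A T0110] [Module Aᵐᵒᵖ T0110]
  [IsScalarTower ℂ A T0110] [IsScalarTower ℂ Aᵐᵒᵖ T0110] [SMulCommClass A Aᵐᵒᵖ T0110]
variable {T1001 : Type*} [AddCommGroup T1001] [Module ℂ T1001] [Module A T1001] [Module Aᵐᵒᵖ T1001]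
  [IsScalarTower ℂ A T1001] [IsScalarTower ℂ Aᵐᵒᵖ T1001] [SMulCommClass A Aᵐᵒᵖ T1001]
variable {T1001E : Type*} [AddCommGroup T1001E] [Module ℂ T1001E] [Module A T1001E] [Module Aᵐᵒᵖ T1001E]
  [IsScalarTower ℂ A T1001E] [IsScalarTower ℂ Aᵐᵒᵖ T1001E] [SMulCommClass A Aᵐᵒᵖ T1001E]

theorem stmt_14
    (pd : A →ₗ[ℂ] Ω10)
    (hpd : ∀ a b : A, pd (a * b) = a • pd b + op b • pd a)
    (pdb : A →ₗ[ℂ] Ω01)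
    (hpdb : ∀ a b : A, pdb (a * b) = a • pdb b + op b • pdb a)
    (w10 : Ω10 →ₗ[ℂ] Ω01 →ₗ[ℂ] Ω11)
    (hw10l : ∀ (a : A) (ω : Ω10) (η : Ω01), w10 (a • ω) η = a • w10 ω η)
    (hw10r : ∀ (ω : Ω10) (η : Ω01) (a : A), w10 ω (op a • η) = op a • w10 ω η)
    (hw10bal : ∀ (ω : Ω10) (a : A) (η : Ω01), w10 (op a • ω) η = w10 ω (a • η))
    (w01 : Ω01 →ₗ[ℂ] Ω10 →ₗ[ℂ] Ω11)
    (hw01l : ∀ (a : A) (η : Ω01) (ω : Ω10), w01 (a • η) ω = a • w01 η ω)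
    (hw01r : ∀ (η : Ω01) (ω : Ω10) (a : A), w01 η (op a • ω) = op a • w01 η ω)
    (hw01bal : ∀ (η : Ω01) (a : A) (ω : Ω10), w01 (op a • η) ω = w01 η (a • ω))
    (pdb1 : Ω10 →ₗ[ℂ] Ω11)
    (pd1 : Ω01 →ₗ[ℂ] Ω11)
    (hpdb1l : ∀ (a : A) (ω : Ω10), pdb1 (a • ω) = w01 (pdb a) ω + a • pdb1 ω)
    (hpdb1r : ∀ (ω : Ω10) (a : A), pdb1 (op a • ω) = op a • pdb1 ω - w10 ω (pdb a))
    (hpd1l : ∀ (a : A) (η : Ω01), pd1 (a • η) = w10 (pd a) η + a • pd1 η)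
    (hpd1r : ∀ (η : Ω01) (a : A), pd1 (op a • η) = op a • pd1 η - w01 η (pd a))
    (hmixed : ∀ a : A, pd1 (pdb a) + pdb1 (pd a) = 0)
    (hspanΩ11 : Submodule.span ℂ {x : Ω11 | ∃ η ω, x = w01 η ω} = ⊤)
    (hμuniv : ∀ (V : Type*) [AddCommGroup V] [Module ℂ V] (f : Ω01 →ₗ[ℂ] Ω10 →ₗ[ℂ] V), (∀ (η : Ω01) (a : A) (ω : Ω10), f (op a • η) ω = f η (a • ω)) → ∃ g : Ω11 →ₗ[ℂ] V, ∀ η ω, g (w01 η ω) = f η ω)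
    (t01E : Ω01 →ₗ[ℂ] E →ₗ[ℂ] T01E)
    (ht01El : ∀ (a : A) (η : Ω01) (e : E), t01E (a • η) e = a • t01E η e)
    (ht01Ebal : ∀ (η : Ω01) (a : A) (e : E), t01E (op a • η) e = t01E η (a • e))
    (ht01Er : ∀ (η : Ω01) (e : E) (a : A), t01E η (op a • e) = op a • t01E η e)
    (ht01Espan : Submodule.span ℂ {z : T01E | ∃ η e, z = t01E η e} = ⊤)
    (ht01Euniv : ∀ (V : Type*) [AddCommGroup V] [Module ℂ V] (f : Ω01 →ₗ[ℂ] E →ₗ[ℂ] V), (∀ (η : Ω01) (a : A) (e : E), f (op a • η) e = f η (a • e)) → ∃ g : T01E →ₗ[ℂ] V, ∀ η e, g (t01E η e) = f η e)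
    (t10E : Ω10 →ₗ[ℂ] E →ₗ[ℂ] T10E)
    (ht10El : ∀ (a : A) (ω : Ω10) (e : E), t10E (a • ω) e = a • t10E ω e)
    (ht10Ebal : ∀ (ω : Ω10) (a : A) (e : E), t10E (op a • ω) e = t10E ω (a • e))
    (ht10Er : ∀ (ω : Ω10) (e : E) (a : A), t10E ω (op a • e) = op a • t10E ω e)
    (ht10Espan : Submodule.span ℂ {z : T10E | ∃ ω e, z = t10E ω e} = ⊤)
    (ht10Euniv : ∀ (V : Type*) [AddCommGroup V] [Module ℂ V] (f : Ω10 →ₗ[ℂ] E →ₗ[ℂ] V), (∀ (ω : Ω10) (a : A) (e : E), f (op a • ω) e = f ω (a • e)) → ∃ g : T10E →ₗ[ℂ] V, ∀ ω e, g (t10E ω e) = f ω e)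
    (tE10 : E →ₗ[ℂ] Ω10 →ₗ[ℂ] TE10)
    (htE10l : ∀ (a : A) (e : E) (ω : Ω10), tE10 (a • e) ω = a • tE10 e ω)
    (htE10bal : ∀ (e : E) (a : A) (ω : Ω10), tE10 (op a • e) ω = tE10 e (a • ω))
    (htE10r : ∀ (e : E) (ω : Ω10) (a : A), tE10 e (op a • ω) = op a • tE10 e ω)
    (htE10span : Submodule.span ℂ {z : TE10 | ∃ e ω, z = tE10 e ω} = ⊤)
    (htE10univ : ∀ (V : Type*) [AddCommGroup V] [Module ℂ V] (f : E →ₗ[ℂ] Ω10 →ₗ[ℂ] V), (∀ (e : E) (a : A) (ω : Ω10), f (op a • e) ω = f e (a • ω)) → ∃ g : TE10 →ₗ[ℂ] V, ∀ e ω, g (tE10 e ω) = f e ω)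
    (tE01 : E →ₗ[ℂ] Ω01 →ₗ[ℂ] TE01)
    (htE01l : ∀ (a : A) (e : E) (η : Ω01), tE01 (a • e) η = a • tE01 e η)
    (htE01bal : ∀ (e : E) (a : A) (η : Ω01), tE01 (op a • e) η = tE01 e (a • η))
    (htE01r : ∀ (e : E) (η : Ω01) (a : A), tE01 e (op a • η) = op a • tE01 e η)
    (htE01span : Submodule.span ℂ {z : TE01 | ∃ e η, z = tE01 e η} = ⊤)
    (htE01univ : ∀ (V : Type*) [AddCommGroup V] [Module ℂ V] (f : E →ₗ[ℂ] Ω01 →ₗ[ℂ] V), (∀ (e : E) (a : A) (η : Ω01), f (op a • e) η = f e (a • η)) → ∃ g : TE01 →ₗ[ℂ] V, ∀ e η, g (tE01 e η) = f e η)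
    (σE : TE10 →ₗ[ℂ] T10E)
    (hσEl : ∀ (a : A) (x : TE10), σE (a • x) = a • σE x)
    (hσEr : ∀ (a : A) (x : TE10), σE (op a • x) = op a • σE x)
    (σbE : TE01 →ₗ[ℂ] T01E)
    (hσbEl : ∀ (a : A) (x : TE01), σbE (a • x) = a • σbE x)
    (hσbEr : ∀ (a : A) (x : TE01), σbE (op a • x) = op a • σbE x)
    (nabE : E →ₗ[ℂ] T01E)
    (hnabE : ∀ (a : A) (e : E), nabE (a • e) = a • nabE e + t01E (pdb a) e)
    (hnabEr : ∀ (e : E) (a : A), nabE (op a • e) = op a • nabE e + σbE (tE01 e (pdb a)))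
    (t011E : Ω01 →ₗ[ℂ] T10E →ₗ[ℂ] T011E)
    (ht011El : ∀ (a : A) (η : Ω01) (ξ : T10E), t011E (a • η) ξ = a • t011E η ξ)
    (ht011Ebal : ∀ (η : Ω01) (a : A) (ξ : T10E), t011E (op a • η) ξ = t011E η (a • ξ))
    (ht011Er : ∀ (η : Ω01) (ξ : T10E) (a : A), t011E η (op a • ξ) = op a • t011E η ξ)
    (ht011Espan : Submodule.span ℂ {z : T011E | ∃ η ξ, z = t011E η ξ} = ⊤)
    (ht011Euniv : ∀ (V : Type*) [AddCommGroup V] [Module ℂ V] (f : Ω01 →ₗ[ℂ] T10E →ₗ[ℂ] V), (∀ (η : Ω01) (a : A) (ξ : T10E), f (op a • η) ξ = f η (a • ξ)) → ∃ g : T011E →ₗ[ℂ] V, ∀ η ξ, g (t011E η ξ) = f η ξ)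
    (t11E : Ω11 →ₗ[ℂ] E →ₗ[ℂ] T11E)
    (ht11El : ∀ (a : A) (ρ : Ω11) (e : E), t11E (a • ρ) e = a • t11E ρ e)
    (ht11Ebal : ∀ (ρ : Ω11) (a : A) (e : E), t11E (op a • ρ) e = t11E ρ (a • e))
    (ht11Er : ∀ (ρ : Ω11) (e : E) (a : A), t11E ρ (op a • e) = op a • t11E ρ e)
    (ht11Espan : Submodule.span ℂ {z : T11E | ∃ ρ e, z = t11E ρ e} = ⊤)
    (ht11Euniv : ∀ (V : Type*) [AddCommGroup V] [Module ℂ V] (f : Ω11 →ₗ[ℂ] E →ₗ[ℂ] V), (∀ (ρ : Ω11) (a : A) (e : E), f (op a • ρ) e = f ρ (a • e)) → ∃ g : T11E →ₗ[ℂ] V, ∀ ρ e, g (t11E ρ e) = f ρ e)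
    (pcon : E →ₗ[ℂ] T10E)
    (hpcon : ∀ (a : A) (e : E), pcon (a • e) = a • pcon e + t10E (pd a) e)
    (hpconr : ∀ (e : E) (a : A), pcon (op a • e) = op a • pcon e + σE (tE10 e (pd a)))
    (μE : T011E ≃ₗ[ℂ] T11E)
    (hμE : ∀ (η : Ω01) (ω : Ω10) (e : E), μE (t011E η (t10E ω e)) = t11E (w01 η ω) e)
    (hμEl : ∀ (a : A) (x : T011E), μE (a • x) = a • μE x)
    (t0110 : Ω01 →ₗ[ℂ] Ω10 →ₗ[ℂ] T0110)
    (ht0110l : ∀ (a : A) (η : Ω01) (ω : Ω10), t0110 (a • η) ω = a • t0110 η ω)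
    (ht0110bal : ∀ (η : Ω01) (a : A) (ω : Ω10), t0110 (op a • η) ω = t0110 η (a • ω))
    (ht0110r : ∀ (η : Ω01) (ω : Ω10) (a : A), t0110 η (op a • ω) = op a • t0110 η ω)
    (ht0110span : Submodule.span ℂ {z : T0110 | ∃ η ω, z = t0110 η ω} = ⊤)
    (ht0110univ : ∀ (V : Type*) [AddCommGroup V] [Module ℂ V] (f : Ω01 →ₗ[ℂ] Ω10 →ₗ[ℂ] V), (∀ (η : Ω01) (a : A) (ω : Ω10), f (op a • η) ω = f η (a • ω)) → ∃ g : T0110 →ₗ[ℂ] V, ∀ η ω, g (t0110 η ω) = f η ω)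
    (μiso : T0110 ≃ₗ[ℂ] Ω11)
    (hμiso : ∀ (η : Ω01) (ω : Ω10), μiso (t0110 η ω) = w01 η ω)
    (hμisol : ∀ (a : A) (x : T0110), μiso (a • x) = a • μiso x)
    (hμisor : ∀ (a : A) (x : T0110), μiso (op a • x) = op a • μiso x)
    (t1001 : Ω10 →ₗ[ℂ] Ω01 →ₗ[ℂ] T1001)
    (ht1001l : ∀ (a : A) (ω : Ω10) (η : Ω01), t1001 (a • ω) η = a • t1001 ω η)
    (ht1001bal : ∀ (ω : Ω10) (a : A) (η : Ω01), t1001 (op a • ω) η = t1001 ω (a • η))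
    (ht1001r : ∀ (ω : Ω10) (η : Ω01) (a : A), t1001 ω (op a • η) = op a • t1001 ω η)
    (ht1001span : Submodule.span ℂ {z : T1001 | ∃ ω η, z = t1001 ω η} = ⊤)
    (ht1001univ : ∀ (V : Type*) [AddCommGroup V] [Module ℂ V] (f : Ω10 →ₗ[ℂ] Ω01 →ₗ[ℂ] V), (∀ (ω : Ω10) (a : A) (η : Ω01), f (op a • ω) η = f ω (a • η)) → ∃ g : T1001 →ₗ[ℂ] V, ∀ ω η, g (t1001 ω η) = f ω η)
    (Φ2 : T0110 →ₗ[ℂ] T1001)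
    (hΦ2l : ∀ (a : A) (x : T0110), Φ2 (a • x) = a • Φ2 x)
    (hΦ2r : ∀ (a : A) (x : T0110), Φ2 (op a • x) = op a • Φ2 x)
    (t1001E : Ω10 →ₗ[ℂ] T01E →ₗ[ℂ] T1001E)
    (ht1001El : ∀ (a : A) (ω : Ω10) (x : T01E), t1001E (a • ω) x = a • t1001E ω x)
    (ht1001Ebal : ∀ (ω : Ω10) (a : A) (x : T01E), t1001E (op a • ω) x = t1001E ω (a • x))
    (ht1001Er : ∀ (ω : Ω10) (x : T01E) (a : A), t1001E ω (op a • x) = op a • t1001E ω x)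
    (ht1001Espan : Submodule.span ℂ {z : T1001E | ∃ ω x, z = t1001E ω x} = ⊤)
    (ht1001Euniv : ∀ (V : Type*) [AddCommGroup V] [Module ℂ V] (f : Ω10 →ₗ[ℂ] T01E →ₗ[ℂ] V), (∀ (ω : Ω10) (a : A) (x : T01E), f (op a • ω) x = f ω (a • x)) → ∃ g : T1001E →ₗ[ℂ] V, ∀ ω x, g (t1001E ω x) = f ω x)
    (pair2 : T1001 →ₗ[ℂ] E →ₗ[ℂ] T1001E)
    (hpair2 : ∀ (ω : Ω10) (η : Ω01) (e : E), pair2 (t1001 ω η) e = t1001E ω (t01E η e))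
    (hpair2l : ∀ (a : A) (x : T1001) (e : E), pair2 (a • x) e = a • pair2 x e)
    (hpair2bal : ∀ (x : T1001) (a : A) (e : E), pair2 (op a • x) e = pair2 x (a • e))
    (hpair2r : ∀ (x : T1001) (e : E) (a : A), pair2 x (op a • e) = op a • pair2 x e)
    (ΦμE : T11E →ₗ[ℂ] T1001E)
    (hΦμE : ∀ (ρ : Ω11) (e : E), ΦμE (t11E ρ e) = pair2 (Φ2 (μiso.symm ρ)) e)
    (PhiE : T011E →ₗ[ℂ] T1001E)
    (hPhiE : ∀ (η : Ω01) (ω : Ω10) (e : E), PhiE (t011E η (t10E ω e)) = pair2 (Φ2 (t0110 η ω)) e)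
    (D10 : T01E →ₗ[ℂ] T11E)
    (hD10 : ∀ (η : Ω01) (e : E), D10 (t01E η e) = -(t11E (pd1 η) e) + μE (t011E η (pcon e)))
    :
    ∀ (η : Ω01) (e : E) (b : A),
      ΦμE (D10 (t01E η (op b • e)))
        = op b • ΦμE (D10 (t01E η e)) + PhiE (t011E η (σE (tE10 e (pd b)))) := by
  have hΦμE_right (b : A) (x : T11E) : ΦμE (op b • x) = op b • ΦμE x := by
    refine ΦμE.map_smul_of_span_eq_top ht11Espan (op b) ?_ x
    rintro _ ⟨ρ, e, rfl⟩
    rw [← ht11Er, hΦμE, hΦμE, hpair2r]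
  have hμE_t011E_right (b : A) (η : Ω01) (ξ : T10E) :
      μE (t011E η (op b • ξ)) = op b • μE (t011E η ξ) := by
    refine (μE.toLinearMap ∘ₗ t011E η).map_smul_of_span_eq_top ht10Espan (op b) ?_ ξ
    rintro _ ⟨ω, e, rfl⟩
    simp only [LinearMap.comp_apply, LinearEquiv.coe_coe]
    rw [← ht10Er, hμE, hμE, ht11Er]
  have hΦμE_μE (η : Ω01) (ξ : T10E) : ΦμE (μE (t011E η ξ)) = PhiE (t011E η ξ) := by
    refine LinearMap.congr_fun (LinearMap.ext_on (f := ΦμE ∘ₗ μE.toLinearMap ∘ₗ t011E η)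
      (g := PhiE ∘ₗ t011E η) ht10Espan ?_) ξ
    rintro _ ⟨ω, e, rfl⟩
    simp only [LinearMap.comp_apply, LinearEquiv.coe_coe]
    rw [hμE, hΦμE, hPhiE, ← hμiso, LinearEquiv.symm_apply_apply]
  have hD10_right (η : Ω01) (e : E) (b : A) :
      D10 (t01E η (op b • e)) = op b • D10 (t01E η e) + μE (t011E η (σE (tE10 e (pd b)))) := by
    rw [hD10, hD10, hpconr, map_add, map_add, hμE_t011E_right, ht11Er, smul_add, smul_neg,
      add_assoc]
  intro η e b
  rw [hD10_right, map_add, hΦμE_right, hΦμE_μE]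
end

section
/- Let (E, ∇̄_E) be a holomorphic vector bundle over a noncommutative complex curve A such that E is an A-bimodule, ∇̄_E is a σ̄_E-bimodule ∂̄-connection, and σ_E : E ⊗_A Ω¹⁰ → Ω¹⁰ ⊗_A E is an A-bimodule map. Then for all a ∈ A, e ∈ E and ω ∈ Ω¹⁰, D̃_E(σ_E(e ⊗ ω)·a) = D̃_E(σ_E(e ⊗ ω))·a + ψ₀(σ_E(e ⊗ ω) ⊗ ∂̄a). Consequently, if σ_E is surjective, then D̃_E is a ψ₀-bimodule ∂̄-connection on Ω¹⁰ ⊗_A E, i.e. D̃_E(ξ·a) = D̃_E(ξ)·a + ψ₀(ξ ⊗ ∂̄a) for all ξ ∈ Ω¹⁰ ⊗_A E and a ∈ A. -/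
open MulOpposite Finset

variable {A : Type*} [Ring A] [Algebra ℂ A]
variable {Ω10 : Type*} [AddCommGroup Ω10] [Module ℂ Ω10] [Module A Ω10] [Module Aᵐᵒᵖ Ω10]
  [IsScalarTower ℂ A Ω10] [IsScalarTower ℂ Aᵐᵒᵖ Ω10] [SMulCommClass A Aᵐᵒᵖ Ω10]
variable {Ω01 : Type*} [AddCommGroup Ω01] [Module ℂ Ω01] [Module A Ω01] [Module Aᵐᵒᵖ Ω01]
  [IsScalarTower ℂ A Ω01] [IsScalarTower ℂ Aᵐᵒᵖ Ω01] [SMulCommClass A Aᵐᵒᵖ Ω01]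
variable {Ω11 : Type*} [AddCommGroup Ω11] [Module ℂ Ω11] [Module A Ω11] [Module Aᵐᵒᵖ Ω11]
  [IsScalarTower ℂ A Ω11] [IsScalarTower ℂ Aᵐᵒᵖ Ω11] [SMulCommClass A Aᵐᵒᵖ Ω11]
variable [Module.Finite A Ω10] [Module.Projective A Ω10]
variable {E : Type*} [AddCommGroup E] [Module ℂ E] [Module A E] [Module Aᵐᵒᵖ E]
  [IsScalarTower ℂ A E] [IsScalarTower ℂ Aᵐᵒᵖ E] [SMulCommClass A Aᵐᵒᵖ E]
variable [Module.Finite A E] [Module.Projective A E]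
variable {T01E : Type*} [AddCommGroup T01E] [Module ℂ T01E] [Module A T01E] [Module Aᵐᵒᵖ T01E]
  [IsScalarTower ℂ A T01E] [IsScalarTower ℂ Aᵐᵒᵖ T01E] [SMulCommClass A Aᵐᵒᵖ T01E]
variable {T10E : Type*} [AddCommGroup T10E] [Module ℂ T10E] [Module A T10E] [Module Aᵐᵒᵖ T10E]
  [IsScalarTower ℂ A T10E] [IsScalarTower ℂ Aᵐᵒᵖ T10E] [SMulCommClass A Aᵐᵒᵖ T10E]
variable {TE10 : Type*} [AddCommGroup TE10] [Module ℂ TE10] [Module A TE10] [Module Aᵐᵒᵖ TE10]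
  [IsScalarTower ℂ A TE10] [IsScalarTower ℂ Aᵐᵒᵖ TE10] [SMulCommClass A Aᵐᵒᵖ TE10]
variable {TE01 : Type*} [AddCommGroup TE01] [Module ℂ TE01] [Module A TE01] [Module Aᵐᵒᵖ TE01]
  [IsScalarTower ℂ A TE01] [IsScalarTower ℂ Aᵐᵒᵖ TE01] [SMulCommClass A Aᵐᵒᵖ TE01]
variable {T011E : Type*} [AddCommGroup T011E] [Module ℂ T011E] [Module A T011E] [Module Aᵐᵒᵖ T011E]
  [IsScalarTower ℂ A T011E] [IsScalarTower ℂ Aᵐᵒᵖ T011E] [SMulCommClass A Aᵐᵒᵖ T011E]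
variable {T11E : Type*} [AddCommGroup T11E] [Module ℂ T11E] [Module A T11E] [Module Aᵐᵒᵖ T11E]
  [IsScalarTower ℂ A T11E] [IsScalarTower ℂ Aᵐᵒᵖ T11E] [SMulCommClass A Aᵐᵒᵖ T11E]
variable {TXE : Type*} [AddCommGroup TXE] [Module ℂ TXE] [Module A TXE] [Module Aᵐᵒᵖ TXE]
  [IsScalarTower ℂ A TXE] [IsScalarTower ℂ Aᵐᵒᵖ TXE] [SMulCommClass A Aᵐᵒᵖ TXE]

theorem stmt_17
    (pd : A →ₗ[ℂ] Ω10)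
    (hpd : ∀ a b : A, pd (a * b) = a • pd b + op b • pd a)
    (pdb : A →ₗ[ℂ] Ω01)
    (hpdb : ∀ a b : A, pdb (a * b) = a • pdb b + op b • pdb a)
    (w10 : Ω10 →ₗ[ℂ] Ω01 →ₗ[ℂ] Ω11)
    (hw10l : ∀ (a : A) (ω : Ω10) (η : Ω01), w10 (a • ω) η = a • w10 ω η)
    (hw10r : ∀ (ω : Ω10) (η : Ω01) (a : A), w10 ω (op a • η) = op a • w10 ω η)
    (hw10bal : ∀ (ω : Ω10) (a : A) (η : Ω01), w10 (op a • ω) η = w10 ω (a • η))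
    (w01 : Ω01 →ₗ[ℂ] Ω10 →ₗ[ℂ] Ω11)
    (hw01l : ∀ (a : A) (η : Ω01) (ω : Ω10), w01 (a • η) ω = a • w01 η ω)
    (hw01r : ∀ (η : Ω01) (ω : Ω10) (a : A), w01 η (op a • ω) = op a • w01 η ω)
    (hw01bal : ∀ (η : Ω01) (a : A) (ω : Ω10), w01 (op a • η) ω = w01 η (a • ω))
    (pdb1 : Ω10 →ₗ[ℂ] Ω11)
    (pd1 : Ω01 →ₗ[ℂ] Ω11)
    (hpdb1l : ∀ (a : A) (ω : Ω10), pdb1 (a • ω) = w01 (pdb a) ω + a • pdb1 ω)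
    (hpdb1r : ∀ (ω : Ω10) (a : A), pdb1 (op a • ω) = op a • pdb1 ω - w10 ω (pdb a))
    (hpd1l : ∀ (a : A) (η : Ω01), pd1 (a • η) = w10 (pd a) η + a • pd1 η)
    (hpd1r : ∀ (η : Ω01) (a : A), pd1 (op a • η) = op a • pd1 η - w01 η (pd a))
    (hmixed : ∀ a : A, pd1 (pdb a) + pdb1 (pd a) = 0)
    (hspanΩ11 : Submodule.span ℂ {x : Ω11 | ∃ η ω, x = w01 η ω} = ⊤)
    (hμuniv : ∀ (V : Type*) [AddCommGroup V] [Module ℂ V] (f : Ω01 →ₗ[ℂ] Ω10 →ₗ[ℂ] V), (∀ (η : Ω01) (a : A) (ω : Ω10), f (op a • η) ω = f η (a • ω)) → ∃ g : Ω11 →ₗ[ℂ] V, ∀ η ω, g (w01 η ω) = f η ω)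
    (t01E : Ω01 →ₗ[ℂ] E →ₗ[ℂ] T01E)
    (ht01El : ∀ (a : A) (η : Ω01) (e : E), t01E (a • η) e = a • t01E η e)
    (ht01Ebal : ∀ (η : Ω01) (a : A) (e : E), t01E (op a • η) e = t01E η (a • e))
    (ht01Er : ∀ (η : Ω01) (e : E) (a : A), t01E η (op a • e) = op a • t01E η e)
    (ht01Espan : Submodule.span ℂ {z : T01E | ∃ η e, z = t01E η e} = ⊤)
    (ht01Euniv : ∀ (V : Type*) [AddCommGroup V] [Module ℂ V] (f : Ω01 →ₗ[ℂ] E →ₗ[ℂ] V), (∀ (η : Ω01) (a : A) (e : E), f (op a • η) e = f η (a • e)) → ∃ g : T01E →ₗ[ℂ] V, ∀ η e, g (t01E η e) = f η e)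
    (t10E : Ω10 →ₗ[ℂ] E →ₗ[ℂ] T10E)
    (ht10El : ∀ (a : A) (ω : Ω10) (e : E), t10E (a • ω) e = a • t10E ω e)
    (ht10Ebal : ∀ (ω : Ω10) (a : A) (e : E), t10E (op a • ω) e = t10E ω (a • e))
    (ht10Er : ∀ (ω : Ω10) (e : E) (a : A), t10E ω (op a • e) = op a • t10E ω e)
    (ht10Espan : Submodule.span ℂ {z : T10E | ∃ ω e, z = t10E ω e} = ⊤)
    (ht10Euniv : ∀ (V : Type*) [AddCommGroup V] [Module ℂ V] (f : Ω10 →ₗ[ℂ] E →ₗ[ℂ] V), (∀ (ω : Ω10) (a : A) (e : E), f (op a • ω) e = f ω (a • e)) → ∃ g : T10E →ₗ[ℂ] V, ∀ ω e, g (t10E ω e) = f ω e)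
    (tE10 : E →ₗ[ℂ] Ω10 →ₗ[ℂ] TE10)
    (htE10l : ∀ (a : A) (e : E) (ω : Ω10), tE10 (a • e) ω = a • tE10 e ω)
    (htE10bal : ∀ (e : E) (a : A) (ω : Ω10), tE10 (op a • e) ω = tE10 e (a • ω))
    (htE10r : ∀ (e : E) (ω : Ω10) (a : A), tE10 e (op a • ω) = op a • tE10 e ω)
    (htE10span : Submodule.span ℂ {z : TE10 | ∃ e ω, z = tE10 e ω} = ⊤)
    (htE10univ : ∀ (V : Type*) [AddCommGroup V] [Module ℂ V] (f : E →ₗ[ℂ] Ω10 →ₗ[ℂ] V), (∀ (e : E) (a : A) (ω : Ω10), f (op a • e) ω = f e (a • ω)) → ∃ g : TE10 →ₗ[ℂ] V, ∀ e ω, g (tE10 e ω) = f e ω)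
    (tE01 : E →ₗ[ℂ] Ω01 →ₗ[ℂ] TE01)
    (htE01l : ∀ (a : A) (e : E) (η : Ω01), tE01 (a • e) η = a • tE01 e η)
    (htE01bal : ∀ (e : E) (a : A) (η : Ω01), tE01 (op a • e) η = tE01 e (a • η))
    (htE01r : ∀ (e : E) (η : Ω01) (a : A), tE01 e (op a • η) = op a • tE01 e η)
    (htE01span : Submodule.span ℂ {z : TE01 | ∃ e η, z = tE01 e η} = ⊤)
    (htE01univ : ∀ (V : Type*) [AddCommGroup V] [Module ℂ V] (f : E →ₗ[ℂ] Ω01 →ₗ[ℂ] V), (∀ (e : E) (a : A) (η : Ω01), f (op a • e) η = f e (a • η)) → ∃ g : TE01 →ₗ[ℂ] V, ∀ e η, g (tE01 e η) = f e η)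
    (σE : TE10 →ₗ[ℂ] T10E)
    (hσEl : ∀ (a : A) (x : TE10), σE (a • x) = a • σE x)
    (hσEr : ∀ (a : A) (x : TE10), σE (op a • x) = op a • σE x)
    (σbE : TE01 →ₗ[ℂ] T01E)
    (hσbEl : ∀ (a : A) (x : TE01), σbE (a • x) = a • σbE x)
    (hσbEr : ∀ (a : A) (x : TE01), σbE (op a • x) = op a • σbE x)
    (nabE : E →ₗ[ℂ] T01E)
    (hnabE : ∀ (a : A) (e : E), nabE (a • e) = a • nabE e + t01E (pdb a) e)
    (hnabEr : ∀ (e : E) (a : A), nabE (op a • e) = op a • nabE e + σbE (tE01 e (pdb a)))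
    (t011E : Ω01 →ₗ[ℂ] T10E →ₗ[ℂ] T011E)
    (ht011El : ∀ (a : A) (η : Ω01) (ξ : T10E), t011E (a • η) ξ = a • t011E η ξ)
    (ht011Ebal : ∀ (η : Ω01) (a : A) (ξ : T10E), t011E (op a • η) ξ = t011E η (a • ξ))
    (ht011Er : ∀ (η : Ω01) (ξ : T10E) (a : A), t011E η (op a • ξ) = op a • t011E η ξ)
    (ht011Espan : Submodule.span ℂ {z : T011E | ∃ η ξ, z = t011E η ξ} = ⊤)
    (ht011Euniv : ∀ (V : Type*) [AddCommGroup V] [Module ℂ V] (f : Ω01 →ₗ[ℂ] T10E →ₗ[ℂ] V), (∀ (η : Ω01) (a : A) (ξ : T10E), f (op a • η) ξ = f η (a • ξ)) → ∃ g : T011E →ₗ[ℂ] V, ∀ η ξ, g (t011E η ξ) = f η ξ)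
    (t11E : Ω11 →ₗ[ℂ] E →ₗ[ℂ] T11E)
    (ht11El : ∀ (a : A) (ρ : Ω11) (e : E), t11E (a • ρ) e = a • t11E ρ e)
    (ht11Ebal : ∀ (ρ : Ω11) (a : A) (e : E), t11E (op a • ρ) e = t11E ρ (a • e))
    (ht11Er : ∀ (ρ : Ω11) (e : E) (a : A), t11E ρ (op a • e) = op a • t11E ρ e)
    (ht11Espan : Submodule.span ℂ {z : T11E | ∃ ρ e, z = t11E ρ e} = ⊤)
    (ht11Euniv : ∀ (V : Type*) [AddCommGroup V] [Module ℂ V] (f : Ω11 →ₗ[ℂ] E →ₗ[ℂ] V), (∀ (ρ : Ω11) (a : A) (e : E), f (op a • ρ) e = f ρ (a • e)) → ∃ g : T11E →ₗ[ℂ] V, ∀ ρ e, g (t11E ρ e) = f ρ e)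
    (tXE : T10E →ₗ[ℂ] Ω01 →ₗ[ℂ] TXE)
    (htXEl : ∀ (a : A) (ξ : T10E) (η : Ω01), tXE (a • ξ) η = a • tXE ξ η)
    (htXEbal : ∀ (ξ : T10E) (a : A) (η : Ω01), tXE (op a • ξ) η = tXE ξ (a • η))
    (htXEr : ∀ (ξ : T10E) (η : Ω01) (a : A), tXE ξ (op a • η) = op a • tXE ξ η)
    (htXEspan : Submodule.span ℂ {z : TXE | ∃ ξ η, z = tXE ξ η} = ⊤)
    (htXEuniv : ∀ (V : Type*) [AddCommGroup V] [Module ℂ V] (f : T10E →ₗ[ℂ] Ω01 →ₗ[ℂ] V), (∀ (ξ : T10E) (a : A) (η : Ω01), f (op a • ξ) η = f ξ (a • η)) → ∃ g : TXE →ₗ[ℂ] V, ∀ ξ η, g (tXE ξ η) = f ξ η)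
    (μE : T011E ≃ₗ[ℂ] T11E)
    (hμE : ∀ (η : Ω01) (ω : Ω10) (e : E), μE (t011E η (t10E ω e)) = t11E (w01 η ω) e)
    (hμEl : ∀ (a : A) (x : T011E), μE (a • x) = a • μE x)
    (wE : Ω10 →ₗ[ℂ] T01E →ₗ[ℂ] T11E)
    (hwE : ∀ (ω : Ω10) (η : Ω01) (e : E), wE ω (t01E η e) = t11E (w10 ω η) e)
    (hwEl : ∀ (a : A) (ω : Ω10) (x : T01E), wE (a • ω) x = a • wE ω x)
    (hwEbal : ∀ (ω : Ω10) (a : A) (x : T01E), wE (op a • ω) x = wE ω (a • x))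
    (DE : T10E →ₗ[ℂ] T11E)
    (hDE : ∀ (ω : Ω10) (e : E), DE (t10E ω e) = t11E (pdb1 ω) e - wE ω (nabE e))
    (ψ0 : TXE →ₗ[ℂ] T011E)
    (hψ0 : ∀ (ω : Ω10) (e : E) (η : Ω01), ψ0 (tXE (t10E ω e) η) = -(μE.symm (wE ω (σbE (tE01 e η)))))
    (hψ0l : ∀ (a : A) (x : TXE), ψ0 (a • x) = a • ψ0 x)
    (hψ0r : ∀ (a : A) (x : TXE), ψ0 (op a • x) = op a • ψ0 x)
    :
    -- the twisted right Leibniz rule on the image of σ_E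
    (∀ (a : A) (e : E) (ω : Ω10),
      μE.symm (DE (op a • σE (tE10 e ω)))
        = op a • μE.symm (DE (σE (tE10 e ω))) + ψ0 (tXE (σE (tE10 e ω)) (pdb a))) ∧
    -- hence if σ_E is surjective, D̃_E is a ψ₀-bimodule ∂̄-connection
    (Function.Surjective σE →
      ∀ (ξ : T10E) (a : A),
        μE.symm (DE (op a • ξ)) = op a • μE.symm (DE ξ) + ψ0 (tXE ξ (pdb a))) := by
  have wE_op : ∀ (ω : Ω10) (a : A) (x : T01E), wE ω (op a • x) = op a • wE ω x := by
    intro ω a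
    refine LinearMap.congr_fun (f := wE ω ∘ₗ Algebra.lsmul ℂ ℂ T01E (op a))
      (g := Algebra.lsmul ℂ ℂ T11E (op a) ∘ₗ wE ω) (LinearMap.ext_on ht01Espan ?_)
    rintro _ ⟨η, e, rfl⟩
    simp [← ht01Er, hwE, ht11Er]
  have μE_op : ∀ (a : A) (x : T011E), μE (op a • x) = op a • μE x := by
    intro a
    refine LinearMap.congr_fun (f := μE.toLinearMap ∘ₗ Algebra.lsmul ℂ ℂ T011E (op a))
      (g := Algebra.lsmul ℂ ℂ T11E (op a) ∘ₗ μE.toLinearMap) (LinearMap.ext_on ht011Espan ?_)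
    rintro _ ⟨η, ξ, rfl⟩
    refine LinearMap.congr_fun
      (f := μE.toLinearMap ∘ₗ Algebra.lsmul ℂ ℂ T011E (op a) ∘ₗ t011E η)
      (g := Algebra.lsmul ℂ ℂ T11E (op a) ∘ₗ μE.toLinearMap ∘ₗ t011E η)
      (LinearMap.ext_on ht10Espan ?_) ξ
    rintro _ ⟨ω, e, rfl⟩
    simp [← ht011Er, ← ht10Er, hμE, ht11Er]
  have μE_symm_op : ∀ (a : A) (x : T11E), μE.symm (op a • x) = op a • μE.symm x := by
    intro a x
    rw [LinearEquiv.symm_apply_eq, μE_op, LinearEquiv.apply_symm_apply]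
  have leibniz : ∀ (a : A) (ξ : T10E),
      μE.symm (DE (op a • ξ)) = op a • μE.symm (DE ξ) + ψ0 (tXE ξ (pdb a)) := by
    intro a
    refine LinearMap.congr_fun
      (f := μE.symm.toLinearMap ∘ₗ DE ∘ₗ Algebra.lsmul ℂ ℂ T10E (op a))
      (g := Algebra.lsmul ℂ ℂ T011E (op a) ∘ₗ μE.symm.toLinearMap ∘ₗ DE +
        ψ0 ∘ₗ tXE.flip (pdb a)) (LinearMap.ext_on ht10Espan ?_)
    rintro _ ⟨ω, e, rfl⟩
    simp only [LinearMap.comp_apply, LinearMap.add_apply, LinearMap.flip_apply,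
      Algebra.lsmul_coe, LinearEquiv.coe_coe]
    rw [← ht10Er, hDE, hDE, hψ0, hnabEr, ht11Er, map_add, wE_op, ← μE_symm_op, smul_sub,
      ← sub_eq_add_neg, ← map_sub, sub_sub]
  exact ⟨fun a e ω => leibniz a _, fun _ ξ a => leibniz a ξ⟩
end
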